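/- For all i, k ∈ {1,…,n} with i ≠ k, β_k(h)·(λ_i^k(h))² = o(h) as h → 0⁺, i.e. β_k(h) (λ_i^k(h))²/h → 0. -/

import Mathlib

open Filter Topology

/-- `β_j(h) = h^{2j} e^{−βγ_j} / Σ_{k=0}^n h^{2k} e^{−βγ_k}`. -/
noncomputable def betaF (n : ℕ) (β : ℝ) (γ : ℕ → ℝ) (j : ℕ) (h : ℝ) : ℝ :=
  h ^ (2 * j) * Real.exp (-β * γ j) /
    ∑ k ∈ Finset.range (n + 1), h ^ (2 * k) * Real.exp (-β * γ k)

/-- `ν_0 = 1`, `ν_k(h) = 1 − β_1(h) − ⋯ − β_k(h)`. -/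
noncomputable def nuF (n : ℕ) (β : ℝ) (γ : ℕ → ℝ) (k : ℕ) (h : ℝ) : ℝ :=
  1 - ∑ m ∈ Finset.Icc 1 k, betaF n β γ m h

/-- `λ_k^j(h)`; the first argument `k` labels the family member (subscript), the
second argument `j` labels the position (superscript). -/
noncomputable def lamF (n : ℕ) (β : ℝ) (γ : ℕ → ℝ) (k j : ℕ) (h : ℝ) : ℝ :=
  if j = k then
    Real.sqrt (nuF n β γ k h) /
      (Real.sqrt (nuF n β γ (k - 1) h) * Real.sqrt (betaF n β γ k h))
  else if j = 0 ∨ k + 1 ≤ j then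
    -Real.sqrt (betaF n β γ k h) /
      (Real.sqrt (nuF n β γ (k - 1) h) * Real.sqrt (nuF n β γ k h))
  else 0


lemma den_cont (n : ℕ) (β : ℝ) (γ : ℕ → ℝ) :
    Continuous (fun h : ℝ => ∑ k ∈ Finset.range (n + 1), h ^ (2 * k) * Real.exp (-β * γ k)) := by
  fun_prop

lemma den_ne (n : ℕ) (β : ℝ) (γ : ℕ → ℝ) :
    ∑ k ∈ Finset.range (n + 1), (0 : ℝ) ^ (2 * k) * Real.exp (-β * γ k) ≠ 0 := by
  rw [Finset.sum_range_succ']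
  simp [Real.exp_ne_zero]

lemma betaF_cont (n : ℕ) (β : ℝ) (γ : ℕ → ℝ) (j : ℕ) : ContinuousAt (betaF n β γ j) 0 := by
  unfold betaF
  exact ContinuousAt.div (by fun_prop) (den_cont n β γ).continuousAt (den_ne n β γ)

lemma nuF_cont (n : ℕ) (β : ℝ) (γ : ℕ → ℝ) (j : ℕ) : ContinuousAt (nuF n β γ j) 0 := by
  unfold nuF
  exact continuousAt_const.sub (tendsto_finsetSum _ fun m _ => betaF_cont n β γ m)

lemma nuF_zero (n : ℕ) (β : ℝ) (γ : ℕ → ℝ) (j : ℕ) : nuF n β γ j 0 = 1 := by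
  unfold nuF
  rw [Finset.sum_eq_zero, sub_zero]
  intro m hm
  have : 2 * m ≠ 0 := by have := (Finset.mem_Icc.1 hm).1; omega
  simp [betaF, zero_pow this]

lemma lamF_cont (n : ℕ) (β : ℝ) (γ : ℕ → ℝ) (i k : ℕ) (hik : i ≠ k) :
    ContinuousAt (lamF n β γ i k) 0 := by
  unfold lamF
  simp only [if_neg hik.symm]
  split_ifs
  · refine ContinuousAt.div (betaF_cont n β γ i).sqrt.neg
      ((nuF_cont n β γ _).sqrt.mul (nuF_cont n β γ _).sqrt) ?_
    simp [nuF_zero]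
  · exact continuousAt_const

/-- for i, k ∈ {1,…,n} with i ≠ k, β_k(h)·(λ_i^k(h))² = o(h) as h → 0⁺. -/
theorem betak_lamik_sq_isLittleO (n : ℕ) (hn : 1 ≤ n) (β : ℝ) (hβ : 0 < β) (γ : ℕ → ℝ)
    (i k : ℕ) (hi : 1 ≤ i) (hin : i ≤ n) (hk : 1 ≤ k) (hkn : k ≤ n) (hik : i ≠ k) :
    Filter.Tendsto (fun h : ℝ => betaF n β γ k h * (lamF n β γ i k h) ^ 2 / h)
      (nhdsWithin 0 (Set.Ioi 0)) (nhds 0) := by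
  have hq : ContinuousAt (fun h : ℝ => h ^ (2 * k - 1) * Real.exp (-β * γ k) /
      (∑ m ∈ Finset.range (n + 1), h ^ (2 * m) * Real.exp (-β * γ m)) *
      (lamF n β γ i k h) ^ 2) 0 :=
    (ContinuousAt.div (by fun_prop) (den_cont n β γ).continuousAt (den_ne n β γ)).mul
      ((lamF_cont n β γ i k hik).pow 2)
  have h0 : 2 * k - 1 ≠ 0 := by omega
  have hq' := hq.tendsto
  simp only [zero_pow h0, zero_mul, zero_div] at hq'
  refine (hq'.mono_left nhdsWithin_le_nhds).congr' ?_
  filter_upwards [self_mem_nhdsWithin] with h hh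
  have hh : h ≠ 0 := ne_of_gt hh
  have e : h ^ (2 * k) = h ^ (2 * k - 1) * h := by
    rw [← pow_succ]; congr 1; omega
  unfold betaF
  rw [e, eq_div_iff hh]
  ring
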